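/- arXiv:2210.16456 — 3 statements merged into one kernel-verified Lean document; each statement's English description precedes it below -/
import Mathlib

section
/- Let n ≥ 1, η > 0, C ∈ ℝ^{n×n}, and let μ, ν ∈ Δ_n have all entries strictly positive. Then the entropically regularized Optimal Transport value min over P ∈ U(μ,ν) of [Σ_{ij} C_ij P_ij + η^{-1} Σ_{ij} P_ij log P_ij] equals the supremum over x, y ∈ ℝ^n of [ -η^{-1} log Σ_{ij} exp(-η(C_ij - x_i - y_j)) + Σ_i μ_i x_i + Σ_j ν_j y_j ], and this supremum is attained. -/
/-- The transportation polytope `U(μ, ν)`: joint distributions with marginals `μ` and `ν`. -/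
def transportPolytope (n : ℕ) (μ ν : Fin n → ℝ) : Set (Matrix (Fin n) (Fin n) ℝ) :=
  {P | (∀ i j, 0 ≤ P i j) ∧ (∑ i, ∑ j, P i j) = 1 ∧
       (∀ i, ∑ j, P i j = μ i) ∧ (∀ j, ∑ i, P i j = ν j)}

/-- Entropically regularized transport cost (convention `0 log 0 = 0` holds since
`Real.log 0 = 0`). -/
noncomputable def entOTObj (n : ℕ) (η : ℝ) (C P : Matrix (Fin n) (Fin n) ℝ) : ℝ :=
  (∑ i, ∑ j, C i j * P i j) + η⁻¹ * ∑ i, ∑ j, P i j * Real.log (P i j)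

/-- Gibbs variational inequality: entropy plus mean energy is at most the log-partition function. -/
theorem sum_mul_sub_sum_mul_log_le_log_sum_exp {ι : Type*} [Fintype ι] (p w : ι → ℝ)
    (hp : ∀ i, 0 ≤ p i) (hsum : ∑ i, p i = 1) :
    ∑ i, p i * w i - ∑ i, p i * Real.log (p i) ≤ Real.log (∑ i, Real.exp (w i)) := by
  have hne : Nonempty ι := by
    by_contra h
    rw [not_nonempty_iff] at h
    simp at hsum
  set Z := ∑ i, Real.exp (w i) with hZ
  have hZpos : 0 < Z := Finset.sum_pos (fun i _ => Real.exp_pos _) Finset.univ_nonempty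
  have key : ∀ i, p i * w i - p i * Real.log (p i) - p i * Real.log Z
      ≤ Real.exp (w i) / Z - p i := by
    intro i
    rcases (hp i).eq_or_lt with h | h
    · rw [← h]
      simp only [zero_mul, sub_zero]
      positivity
    · have h1 := Real.log_le_sub_one_of_pos (x := Real.exp (w i) / (Z * p i)) (by positivity)
      rw [Real.log_div (by positivity) (by positivity), Real.log_exp,
        Real.log_mul hZpos.ne' h.ne'] at h1
      have h2 := mul_le_mul_of_nonneg_left h1 h.le
      have h3 : p i * (Real.exp (w i) / (Z * p i) - 1) = Real.exp (w i) / Z - p i := by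
        field_simp
      linarith
  have hs := Finset.sum_le_sum (fun i (_ : i ∈ Finset.univ) => key i)
  simp only [Finset.sum_sub_distrib, ← Finset.sum_mul, ← Finset.sum_div, hsum, ← hZ,
    div_self hZpos.ne'] at hs
  linarith

theorem sum_add_potentials_mul {n : ℕ} {μ ν : Fin n → ℝ} {P : Matrix (Fin n) (Fin n) ℝ}
    (hP : P ∈ transportPolytope n μ ν) (x y : Fin n → ℝ) :
    ∑ i, ∑ j, (x i + y j) * P i j = ∑ i, μ i * x i + ∑ j, ν j * y j := by
  obtain ⟨-, -, hr, hc⟩ := hP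
  simp only [add_mul, Finset.sum_add_distrib]
  congr 1
  · simp only [← Finset.mul_sum, hr]
    exact Finset.sum_congr rfl fun i _ => mul_comm _ _
  · rw [Finset.sum_comm]
    simp only [← Finset.mul_sum, hc]
    exact Finset.sum_congr rfl fun j _ => mul_comm _ _

/-- Weak duality for entropic optimal transport. -/
theorem entOT_weak_duality {n : ℕ} {η : ℝ} (hη : 0 < η) (C : Matrix (Fin n) (Fin n) ℝ)
    {μ ν : Fin n → ℝ} {P : Matrix (Fin n) (Fin n) ℝ} (hP : P ∈ transportPolytope n μ ν)
    (x y : Fin n → ℝ) :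
    -η⁻¹ * Real.log (∑ i, ∑ j, Real.exp (-η * (C i j - x i - y j)))
      + (∑ i, μ i * x i) + (∑ j, ν j * y j) ≤ entOTObj n η C P := by
  have hg := sum_mul_sub_sum_mul_log_le_log_sum_exp (fun q : Fin n × Fin n => P q.1 q.2)
    (fun q => -η * (C q.1 q.2 - x q.1 - y q.2)) (fun q => hP.1 _ _)
    (by rw [Fintype.sum_prod_type]; exact hP.2.1)
  simp only [Fintype.sum_prod_type] at hg
  have hs := sum_add_potentials_mul hP x y
  have he : ∑ i, ∑ j, P i j * (-η * (C i j - x i - y j))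
      = -η * (∑ i, ∑ j, C i j * P i j - ∑ i, ∑ j, (x i + y j) * P i j) := by
    simp only [← Finset.sum_sub_distrib, Finset.mul_sum]
    refine Finset.sum_congr rfl fun i _ => Finset.sum_congr rfl fun j _ => by ring
  rw [he, hs] at hg
  have h2 := mul_le_mul_of_nonneg_left hg (inv_pos.2 hη).le
  unfold entOTObj
  have h3 : η⁻¹ * (-η * (∑ i, ∑ j, C i j * P i j - (∑ i, μ i * x i + ∑ j, ν j * y j))
      - ∑ i, ∑ j, P i j * Real.log (P i j))
      = -(∑ i, ∑ j, C i j * P i j - (∑ i, μ i * x i + ∑ j, ν j * y j))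
        - η⁻¹ * ∑ i, ∑ j, P i j * Real.log (P i j) := by
    field_simp
  linarith

theorem isCompact_transportPolytope (n : ℕ) (μ ν : Fin n → ℝ) :
    IsCompact (transportPolytope n μ ν) := by
  have hbox : IsCompact (Set.univ.pi fun _ : Fin n => Set.univ.pi fun _ : Fin n =>
      Set.Icc (0 : ℝ) 1) :=
    isCompact_univ_pi fun _ => isCompact_univ_pi fun _ => isCompact_Icc
  refine IsCompact.of_isClosed_subset (s := _) hbox ?_ ?_
  · have he (i j : Fin n) : Continuous fun P : Matrix (Fin n) (Fin n) ℝ => P i j :=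
      continuous_id.matrix_elem i j
    simp only [transportPolytope, Set.ofPred_and, Set.ofPred_forall]
    refine IsClosed.inter ?_ (IsClosed.inter ?_ (IsClosed.inter ?_ ?_))
    · exact isClosed_iInter fun i => isClosed_iInter fun j =>
        isClosed_le continuous_const (he i j)
    · exact isClosed_eq (continuous_finsetSum _ fun i _ => continuous_finsetSum _ fun j _ =>
        he i j) continuous_const
    · exact isClosed_iInter fun i => isClosed_eq (continuous_finsetSum _ fun j _ => he i j)
        continuous_const
    · exact isClosed_iInter fun j => isClosed_eq (continuous_finsetSum _ fun i _ => he i j)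
        continuous_const
  · rintro P ⟨h0, h1, -, -⟩ i - j -
    refine ⟨h0 i j, ?_⟩
    calc P i j ≤ ∑ j, P i j :=
          Finset.single_le_sum (fun j _ => h0 i j) (Finset.mem_univ j)
      _ ≤ ∑ i, ∑ j, P i j :=
          Finset.single_le_sum (f := fun i => ∑ j, P i j)
            (fun i _ => Finset.sum_nonneg fun j _ => h0 i j) (Finset.mem_univ i)
      _ = 1 := h1

theorem continuous_entOTObj (n : ℕ) (η : ℝ) (C : Matrix (Fin n) (Fin n) ℝ) :
    Continuous (entOTObj n η C) := by
  have he (i j : Fin n) : Continuous fun P : Matrix (Fin n) (Fin n) ℝ => P i j :=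
    continuous_id.matrix_elem i j
  unfold entOTObj
  refine Continuous.add ?_ (continuous_const.mul ?_)
  · exact continuous_finsetSum _ fun i _ => continuous_finsetSum _ fun j _ =>
      continuous_const.mul (he i j)
  · exact continuous_finsetSum _ fun i _ => continuous_finsetSum _ fun j _ =>
      Real.continuous_mul_log.comp (he i j)

theorem product_mem_transportPolytope {n : ℕ} {μ ν : Fin n → ℝ}
    (hμ : ∀ i, 0 ≤ μ i) (hμsum : ∑ i, μ i = 1) (hν : ∀ j, 0 ≤ ν j) (hνsum : ∑ j, ν j = 1) :
    (fun i j => μ i * ν j : Matrix (Fin n) (Fin n) ℝ) ∈ transportPolytope n μ ν := by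
  refine ⟨fun i j => mul_nonneg (hμ i) (hν j), ?_, fun i => ?_, fun j => ?_⟩
  · simp only [← Finset.mul_sum, hνsum, mul_one, hμsum]
  · simp only [← Finset.mul_sum, hνsum, mul_one]
  · simp only [← Finset.sum_mul, hμsum, one_mul]

theorem add_smul_mem_transportPolytope {n : ℕ} {μ ν : Fin n → ℝ}
    {P D : Matrix (Fin n) (Fin n) ℝ} (hP : P ∈ transportPolytope n μ ν)
    (hrow : ∀ i, ∑ j, D i j = 0) (hcol : ∀ j, ∑ i, D i j = 0) {t : ℝ}
    (hpos : ∀ i j, 0 ≤ P i j + t * D i j) :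
    (fun i j => P i j + t * D i j : Matrix (Fin n) (Fin n) ℝ) ∈ transportPolytope n μ ν := by
  obtain ⟨-, h1, hr, hc⟩ := hP
  simp only [hr] at h1
  refine ⟨hpos, ?_, fun i => ?_, fun j => ?_⟩ <;>
  simp only [Finset.sum_add_distrib, ← Finset.mul_sum, hrow, hcol, h1, hr, hc, mul_zero,
    add_zero]

/-- Convexity of `p log p`, with the extra gain obtained when leaving `p = 0`. -/
theorem mul_log_segment_le {p r t : ℝ} (hp : 0 ≤ p) (hr : 0 < r) (ht : 0 < t) (ht1 : t < 1) :
    (p + t * (r - p)) * Real.log (p + t * (r - p)) ≤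
      (1 - t) * (p * Real.log p) + t * (r * Real.log r)
        + if p = 0 then r * (t * Real.log t) else 0 := by
  split_ifs with h
  · subst h
    simp only [sub_zero, zero_add, zero_mul, mul_zero]
    rw [Real.log_mul ht.ne' hr.ne']
    linarith
  · have := Real.convexOn_mul_log.2 (Set.mem_Ici.2 hp) (Set.mem_Ici.2 hr.le)
      (sub_nonneg.2 ht1.le) ht.le (sub_add_cancel 1 t)
    simp only [smul_eq_mul] at this
    rw [show p + t * (r - p) = (1 - t) * p + t * r by ring]
    linarith

/-- A minimizer of the entropic objective lies in the interior of the nonnegative orthant. -/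
theorem pos_of_isMinOn_entOTObj {n : ℕ} {η : ℝ} (hη : 0 < η) {C : Matrix (Fin n) (Fin n) ℝ}
    {μ ν : Fin n → ℝ} {P R : Matrix (Fin n) (Fin n) ℝ} (hP : P ∈ transportPolytope n μ ν)
    (hmin : IsMinOn (entOTObj n η C) (transportPolytope n μ ν) P)
    (hR : R ∈ transportPolytope n μ ν) (hRpos : ∀ i j, 0 < R i j) (i j : Fin n) :
    0 < P i j := by
  by_contra hcon
  have hij : P i j = 0 := le_antisymm (not_lt.1 hcon) (hP.1 i j)
  set ρ := ∑ i, ∑ j, if P i j = 0 then R i j else 0 with hρ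
  have hnn : ∀ i j, 0 ≤ if P i j = 0 then R i j else 0 := fun i j => by
    split_ifs
    exacts [(hRpos i j).le, le_rfl]
  have hρpos : 0 < ρ := by
    refine Finset.sum_pos' (fun i _ => Finset.sum_nonneg fun j _ => hnn i j)
      ⟨i, Finset.mem_univ i, Finset.sum_pos' (fun j _ => hnn i j) ⟨j, Finset.mem_univ j, ?_⟩⟩
    rw [if_pos hij]
    exact hRpos i j
  have hbound : ∀ t : ℝ, 0 < t → t < 1 →
      0 ≤ entOTObj n η C R - entOTObj n η C P + η⁻¹ * (ρ * Real.log t) := by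
    intro t ht ht1
    have hmem := add_smul_mem_transportPolytope (D := fun i j => R i j - P i j) (t := t) hP
      (fun i => by simp [Finset.sum_sub_distrib, hR.2.2.1, hP.2.2.1])
      (fun j => by simp [Finset.sum_sub_distrib, hR.2.2.2, hP.2.2.2])
      (fun i j => by nlinarith [hP.1 i j, hRpos i j])
    have hle : entOTObj n η C P ≤ _ := hmin hmem
    have hent : ∑ i, ∑ j, (P i j + t * (R i j - P i j)) * Real.log (P i j + t * (R i j - P i j))
        ≤ (1 - t) * ∑ i, ∑ j, P i j * Real.log (P i j)
          + t * ∑ i, ∑ j, R i j * Real.log (R i j) + ρ * (t * Real.log t) := by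
      simp only [hρ, Finset.mul_sum, Finset.sum_mul, ← Finset.sum_add_distrib]
      refine Finset.sum_le_sum fun i _ => Finset.sum_le_sum fun j _ => ?_
      simpa only [ite_mul, zero_mul] using mul_log_segment_le (hP.1 i j) (hRpos i j) ht ht1
    have hlin : ∑ i, ∑ j, C i j * (P i j + t * (R i j - P i j))
        = (1 - t) * ∑ i, ∑ j, C i j * P i j + t * ∑ i, ∑ j, C i j * R i j := by
      simp only [Finset.mul_sum, ← Finset.sum_add_distrib]
      exact Finset.sum_congr rfl fun i _ => Finset.sum_congr rfl fun j _ => by ring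
    have hent' := mul_le_mul_of_nonneg_left hent (inv_pos.2 hη).le
    refine nonneg_of_mul_nonneg_right (a := t) ?_ ht
    unfold entOTObj at hle ⊢
    rw [hlin] at hle
    linarith
  set K := entOTObj n η C R - entOTObj n η C P with hK
  have hK0 : 0 ≤ K := sub_nonneg.2 (hmin hR)
  have h := hbound (Real.exp (-(η * (K + 1) / ρ))) (Real.exp_pos _)
    (Real.exp_lt_one_iff.2 (neg_neg_of_pos (by positivity)))
  rw [Real.log_exp] at h
  have : η⁻¹ * (ρ * -(η * (K + 1) / ρ)) = -(K + 1) := by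
    field_simp
  linarith

/-- First-order optimality at a positive minimizer along marginal-preserving directions. -/
theorem sum_mul_gradient_eq_zero {n : ℕ} {η : ℝ} {C : Matrix (Fin n) (Fin n) ℝ}
    {μ ν : Fin n → ℝ} {P D : Matrix (Fin n) (Fin n) ℝ} (hP : P ∈ transportPolytope n μ ν)
    (hmin : IsMinOn (entOTObj n η C) (transportPolytope n μ ν) P)
    (hpos : ∀ i j, 0 < P i j)
    (hrow : ∀ i, ∑ j, D i j = 0) (hcol : ∀ j, ∑ i, D i j = 0) :
    ∑ i, ∑ j, D i j * (C i j + η⁻¹ * Real.log (P i j)) = 0 := by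
  have hline (i j : Fin n) : HasDerivAt (fun t : ℝ => P i j + t * D i j) (D i j) 0 := by
    simpa using ((hasDerivAt_id (0 : ℝ)).mul_const (D i j)).const_add (P i j)
  have hderiv : HasDerivAt
      (fun t : ℝ => entOTObj n η C (fun i j => P i j + t * D i j))
      (∑ i, ∑ j, C i j * D i j + η⁻¹ * ∑ i, ∑ j, (Real.log (P i j) + 1) * D i j) 0 := by
    unfold entOTObj
    refine HasDerivAt.add ?_ (HasDerivAt.const_mul _ ?_)
    · exact HasDerivAt.fun_sum fun i _ => HasDerivAt.fun_sum fun j _ =>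
        (hline i j).const_mul (C i j)
    · refine HasDerivAt.fun_sum fun i _ => HasDerivAt.fun_sum fun j _ => ?_
      refine HasDerivAt.comp (h₂ := fun s : ℝ => s * Real.log s) 0 ?_ (hline i j)
      simpa using Real.hasDerivAt_mul_log (hpos i j).ne'
  have hloc : IsLocalMin (fun t : ℝ => entOTObj n η C (fun i j => P i j + t * D i j)) 0 := by
    have hev : ∀ᶠ t : ℝ in nhds 0, ∀ i j, 0 < P i j + t * D i j := by
      refine Filter.eventually_all.2 fun i => Filter.eventually_all.2 fun j => ?_
      refine (hline i j).continuousAt.eventually_const_lt ?_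
      simpa using hpos i j
    filter_upwards [hev] with t ht
    simp only [zero_mul, add_zero]
    exact hmin (add_smul_mem_transportPolytope hP hrow hcol fun i j => (ht i j).le)
  have h0 := hloc.hasDerivAt_eq_zero hderiv
  have hD : ∑ i, ∑ j, D i j = 0 := by simp [hrow]
  have hsplit : ∑ i, ∑ j, D i j * (C i j + η⁻¹ * Real.log (P i j))
      = (∑ i, ∑ j, C i j * D i j + η⁻¹ * ∑ i, ∑ j, (Real.log (P i j) + 1) * D i j)
        - η⁻¹ * ∑ i, ∑ j, D i j := by
    simp only [Finset.mul_sum, ← Finset.sum_add_distrib, ← Finset.sum_sub_distrib]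
    exact Finset.sum_congr rfl fun i _ => Finset.sum_congr rfl fun j _ => by ring
  rw [hsplit, h0, hD, mul_zero, sub_zero]

/-- Dual potentials exist for a positive minimizer. -/
theorem exists_potentials {n : ℕ} {η : ℝ} {C : Matrix (Fin n) (Fin n) ℝ}
    {μ ν : Fin n → ℝ} {P : Matrix (Fin n) (Fin n) ℝ} (hP : P ∈ transportPolytope n μ ν)
    (hmin : IsMinOn (entOTObj n η C) (transportPolytope n μ ν) P)
    (hpos : ∀ i j, 0 < P i j) (k : Fin n) :
    ∃ x y : Fin n → ℝ, ∀ i j, C i j + η⁻¹ * Real.log (P i j) = x i + y j := by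
  set c : Fin n → Fin n → ℝ := fun i j => C i j + η⁻¹ * Real.log (P i j) with hc
  refine ⟨fun i => c i k, fun j => c k j - c k k, fun i j => ?_⟩
  set a : Fin n → Fin n → ℝ := fun i => Pi.single i 1 - Pi.single k 1 with ha
  have hasum (i : Fin n) : ∑ l, a i l = 0 := by simp [ha, Finset.sum_sub_distrib]
  have h := sum_mul_gradient_eq_zero (D := fun l m => a i l * a j m) hP hmin hpos
    (fun l => by simp [← Finset.mul_sum, hasum]) (fun m => by simp [← Finset.sum_mul, hasum])
  have hdiff (i : Fin n) (f : Fin n → ℝ) : ∑ l, a i l * f l = f i - f k := by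
    simp [ha, Pi.single_apply, sub_mul, Finset.sum_sub_distrib]
  have h' : ∑ l, ∑ m, a i l * a j m * c l m = 0 := h
  simp only [mul_assoc, ← Finset.mul_sum, hdiff] at h'
  change c i j = c i k + (c k j - c k k)
  linarith

/-- **Entropic Optimal Transport duality.** The entropic OT value over `U(μ,ν)` equals
`sup_{x,y} [-η⁻¹ log ∑_{ij} exp(-η(C_ij - x_i - y_j)) + ⟨μ,x⟩ + ⟨ν,y⟩]`, and both the
minimum and the supremum are attained. -/
theorem entropic_ot_duality (n : ℕ) (hn : 1 ≤ n) (η : ℝ) (hη : 0 < η)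
    (C : Matrix (Fin n) (Fin n) ℝ) (μ ν : Fin n → ℝ)
    (hμpos : ∀ i, 0 < μ i) (hμsum : ∑ i, μ i = 1)
    (hνpos : ∀ j, 0 < ν j) (hνsum : ∑ j, ν j = 1) :
    ∃ m : ℝ,
      IsLeast {r : ℝ | ∃ P ∈ transportPolytope n μ ν, r = entOTObj n η C P} m ∧
      IsGreatest {r : ℝ | ∃ x y : Fin n → ℝ,
        r = -η⁻¹ * Real.log (∑ i, ∑ j, Real.exp (-η * (C i j - x i - y j)))
            + (∑ i, μ i * x i) + (∑ j, ν j * y j)} m := by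
  have hR := product_mem_transportPolytope (fun i => (hμpos i).le) hμsum
    (fun j => (hνpos j).le) hνsum
  obtain ⟨P, hP, hmin⟩ := (isCompact_transportPolytope n μ ν).exists_isMinOn ⟨_, hR⟩
    (continuous_entOTObj n η C).continuousOn
  have hpos := pos_of_isMinOn_entOTObj hη hP hmin hR fun i j => mul_pos (hμpos i) (hνpos j)
  obtain ⟨x, y, hxy⟩ := exists_potentials hP hmin hpos ⟨0, hn⟩
  refine ⟨entOTObj n η C P, ⟨⟨P, hP, rfl⟩, ?_⟩, ⟨x, y, ?_⟩, ?_⟩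
  · rintro r ⟨Q, hQ, rfl⟩
    exact hmin hQ
  · have hexp (i j : Fin n) : Real.exp (-η * (C i j - x i - y j)) = P i j := by
      have : -η * (C i j - x i - y j) = Real.log (P i j) := by
        rw [show C i j - x i - y j = -(η⁻¹ * Real.log (P i j)) by linarith [hxy i j]]
        field_simp
      rw [this, Real.exp_log (hpos i j)]
    simp only [hexp, hP.2.1, Real.log_one, mul_zero, zero_add]
    rw [← sum_add_potentials_mul hP x y]
    simp only [entOTObj, ← hxy, Finset.mul_sum, ← Finset.sum_add_distrib]
    exact Finset.sum_congr rfl fun i _ => Finset.sum_congr rfl fun j _ => by ring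
  · rintro r ⟨x', y', rfl⟩
    exact entOT_weak_duality hη C hP x' y'
end

section
/- Let n ≥ 2, η > 0, and C ∈ ℝ^{n×n}. Let P_η be the unique minimizer over P in the normalized circulation polytope of Σ_{ij} C_ij P_ij + η^{-1} Σ_{ij} P_ij log P_ij. Then Σ_{ij} C_ij (P_η)_ij ≤ (minimum mean cycle value of C) + 2 η^{-1} log n, where the minimum mean cycle value is the minimum over cycles σ on [n] of (1/|σ|) Σ_{e ∈ σ} C_e. In particular, taking η = 2 ε^{-1} log n, the entropic minimizer solves the Minimum Mean Cycle problem to additive accuracy ε. -/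
/-- The normalized circulation polytope: joint distributions with symmetric marginals. -/
def circulationPolytope (n : ℕ) : Set (Matrix (Fin n) (Fin n) ℝ) :=
  {P | (∀ i j, 0 ≤ P i j) ∧ (∑ i, ∑ j, P i j) = 1 ∧
       (∀ i, ∑ j, P i j = ∑ j, P j i)}

/-- Entropically regularized cost (convention `0 log 0 = 0` holds since
`Real.log 0 = 0`). -/
noncomputable def entMMCObj (n : ℕ) (η : ℝ) (C P : Matrix (Fin n) (Fin n) ℝ) : ℝ :=
  (∑ i, ∑ j, C i j * P i j) + η⁻¹ * ∑ i, ∑ j, P i j * Real.log (P i j)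

/-- The mean cost of the cycle with `k` distinct vertices `v 0, …, v (k-1)` traversed
cyclically, with respect to edge costs `C`. -/
noncomputable def meanCycleCost (n k : ℕ) (hk : 0 < k) (v : Fin k → Fin n)
    (C : Matrix (Fin n) (Fin n) ℝ) : ℝ :=
  (k : ℝ)⁻¹ * ∑ t : Fin k, C (v t) (v ⟨(t.val + 1) % k, Nat.mod_lt _ hk⟩)

/-- The cyclic successor on `Fin k` is a bijection. -/
lemma cyclicSucc_bijective (k : ℕ) (hk : 0 < k) :
    Function.Bijective (fun t : Fin k => (⟨(t.val + 1) % k, Nat.mod_lt _ hk⟩ : Fin k)) := by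
  refine Finite.injective_iff_bijective.mp fun a b hab => ?_
  have h : a.val + 1 ≡ b.val + 1 [MOD k] := congrArg Fin.val hab
  exact Fin.ext (Nat.ModEq.eq_of_lt_of_lt (Nat.ModEq.add_right_cancel' 1 h) a.isLt b.isLt)

/-- The uniform distribution on the edges `(v t, v (s t))`. -/
noncomputable def edgeDistribution {n k : ℕ} (v : Fin k → Fin n) (s : Fin k → Fin k) :
    Matrix (Fin n) (Fin n) ℝ :=
  fun i j => (k : ℝ)⁻¹ * ∑ t : Fin k, if v t = i then (if v (s t) = j then 1 else 0) else 0

lemma sum_sum_mul_edgeDistribution {n k : ℕ} (v : Fin k → Fin n) (s : Fin k → Fin k)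
    (C : Matrix (Fin n) (Fin n) ℝ) :
    ∑ i, ∑ j, C i j * edgeDistribution v s i j = (k : ℝ)⁻¹ * ∑ t, C (v t) (v (s t)) := by
  have h (i j : Fin n) : C i j * edgeDistribution v s i j =
      (k : ℝ)⁻¹ * ∑ t, if v t = i then (if v (s t) = j then C i j else 0) else 0 := by
    rw [edgeDistribution, mul_left_comm, Finset.mul_sum]
    simp
  simp_rw [h, ← Finset.mul_sum]
  congr 1
  rw [Finset.sum_congr rfl fun i _ => Finset.sum_comm, Finset.sum_comm]
  refine Finset.sum_congr rfl fun t _ => ?_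
  rw [Finset.sum_comm]
  simp

lemma edgeDistribution_mem_circulationPolytope {n k : ℕ} (hk : 0 < k) (v : Fin k → Fin n)
    {s : Fin k → Fin k} (hs : Function.Bijective s) :
    edgeDistribution v s ∈ circulationPolytope n := by
  have hk' : (k : ℝ) ≠ 0 := by positivity
  refine ⟨fun i j => ?_, ?_, fun i => ?_⟩
  · unfold edgeDistribution
    positivity
  · simpa [hk'] using sum_sum_mul_edgeDistribution v s (fun _ _ => 1)
  · simp only [edgeDistribution, ← Finset.mul_sum]
    congr 1
    rw [Finset.sum_comm, Finset.sum_comm (s := Finset.univ (α := Fin n))]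
    simpa using (hs.sum_comp fun t => if v t = i then (1 : ℝ) else 0).symm

/-- Negative entropy is nonpositive on the circulation polytope. -/
lemma sum_mul_log_nonpos {n : ℕ} {P : Matrix (Fin n) (Fin n) ℝ}
    (hP : P ∈ circulationPolytope n) : ∑ i, ∑ j, P i j * Real.log (P i j) ≤ 0 := by
  obtain ⟨h0, h1, -⟩ := hP
  refine Finset.sum_nonpos fun i _ => Finset.sum_nonpos fun j _ => ?_
  refine mul_nonpos_of_nonneg_of_nonpos (h0 i j) (Real.log_nonpos (h0 i j) ?_)
  calc P i j ≤ ∑ j, P i j := Finset.single_le_sum (fun j _ => h0 i j) (Finset.mem_univ j)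
    _ ≤ ∑ i, ∑ j, P i j :=
      Finset.single_le_sum (f := fun i => ∑ j, P i j)
        (fun i _ => Finset.sum_nonneg fun j _ => h0 i j) (Finset.mem_univ i)
    _ = 1 := h1

/-- The entropy of a distribution on pairs is at most `2 log n`. -/
lemma neg_two_mul_log_le_sum_mul_log {n : ℕ} (hn : 0 < n) {P : Matrix (Fin n) (Fin n) ℝ}
    (hP : P ∈ circulationPolytope n) :
    -(2 * Real.log n) ≤ ∑ i, ∑ j, P i j * Real.log (P i j) := by
  obtain ⟨h0, h1, -⟩ := hP
  have hn' : (0 : ℝ) < n := by positivity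
  have key (i j : Fin n) :
      P i j - ((n : ℝ) ^ 2)⁻¹ - 2 * Real.log n * P i j ≤ P i j * Real.log (P i j) := by
    rcases (h0 i j).eq_or_lt with h | h
    · rw [← h]
      simp
    · have hl := Real.log_le_sub_one_of_pos (x := ((n : ℝ) ^ 2)⁻¹ * (P i j)⁻¹) (by positivity)
      rw [Real.log_mul (by positivity) (by positivity), Real.log_inv, Real.log_inv,
        Real.log_pow] at hl
      have hm := mul_le_mul_of_nonneg_left hl h.le
      have hc : P i j * (((n : ℝ) ^ 2)⁻¹ * (P i j)⁻¹) = ((n : ℝ) ^ 2)⁻¹ := by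
        field_simp
      rw [mul_sub, hc] at hm
      push_cast at hm
      linarith
  have hsum := Finset.sum_le_sum fun i (_ : i ∈ Finset.univ) =>
    Finset.sum_le_sum fun j (_ : j ∈ Finset.univ) => key i j
  simp only [Finset.sum_sub_distrib, ← Finset.mul_sum, h1, Finset.sum_const, Finset.card_univ,
    Fintype.card_fin, nsmul_eq_mul] at hsum
  have hc : (n : ℝ) * (n * ((n : ℝ) ^ 2)⁻¹) = 1 := by field_simp
  linarith

/-- **Approximation guarantee of entropic MMC.** If `P_η` minimizes the entropic MMC
objective over the normalized circulation polytope, then its (unregularized) cost is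
within `2 η⁻¹ log n` of the minimum mean cycle value (i.e. of every cycle's mean cost,
hence of the least one). In particular, for `η = 2 ε⁻¹ log n` the entropic minimizer
solves MMC to additive accuracy `ε`. -/
theorem entropic_mmc_approx (n : ℕ) (hn : 2 ≤ n) (η : ℝ) (hη : 0 < η)
    (C : Matrix (Fin n) (Fin n) ℝ)
    (Pη : Matrix (Fin n) (Fin n) ℝ)
    (hPη : Pη ∈ circulationPolytope n)
    (hPηmin : ∀ Q ∈ circulationPolytope n, entMMCObj n η C Pη ≤ entMMCObj n η C Q) :
    (∀ (k : ℕ) (hk : 0 < k), k ≤ n → ∀ v : Fin k → Fin n, Function.Injective v →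
      (∑ i, ∑ j, C i j * Pη i j) ≤ meanCycleCost n k hk v C + 2 * η⁻¹ * Real.log n) ∧
    (∀ ε : ℝ, 0 < ε → η = 2 * ε⁻¹ * Real.log n →
      ∀ (k : ℕ) (hk : 0 < k), k ≤ n → ∀ v : Fin k → Fin n, Function.Injective v →
        (∑ i, ∑ j, C i j * Pη i j) ≤ meanCycleCost n k hk v C + ε) := by
  have bound : ∀ (k : ℕ) (hk : 0 < k), ∀ v : Fin k → Fin n,
      (∑ i, ∑ j, C i j * Pη i j) ≤ meanCycleCost n k hk v C + 2 * η⁻¹ * Real.log n := by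
    intro k hk v
    have hQ := edgeDistribution_mem_circulationPolytope hk v (cyclicSucc_bijective k hk)
    have hmin := hPηmin _ hQ
    simp only [entMMCObj, sum_sum_mul_edgeDistribution] at hmin
    have hη' : 0 ≤ η⁻¹ := by positivity
    have hlow := mul_le_mul_of_nonneg_left
      (neg_two_mul_log_le_sum_mul_log (by omega) hPη) hη'
    have hupp := mul_nonpos_of_nonneg_of_nonpos hη' (sum_mul_log_nonpos hQ)
    unfold meanCycleCost
    linarith
  refine ⟨fun k hk _ v _ => bound k hk v, fun ε hε hηε k hk _ v _ => ?_⟩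
  have hlog : 0 < Real.log n := Real.log_pos (by exact_mod_cast hn)
  have hbias : 2 * η⁻¹ * Real.log n = ε := by
    rw [hηε]
    field_simp
  exact hbias ▸ bound k hk v
end

section
/- Let n ≥ 1, let K ∈ ℝ^{n×n} have all entries strictly positive, let μ, ν ∈ Δ_n have all entries strictly positive, and define Φ(x,y) = log(Σ_{ij} K_ij e^{x_i + y_j}) - Σ_i μ_i x_i - Σ_j ν_j y_j. Let (x_t, y_t)_{t ≥ 0} be any sequence in ℝ^n × ℝ^n such that for each t, x_{t+1} is obtained from (x_t, y_t) by the Sinkhorn row update (x_{t+1})_i = (x_t)_i + log(μ_i / (ρ_t)_i), where ρ_t is the row marginal of the normalized matrix p_t with (p_t)_ij = K_ij e^{(x_t)_i + (y_t)_j} / Σ_{kl} K_kl e^{(x_t)_k + (y_t)_l}, and y_{t+1} satisfies Φ(x_{t+1}, y_{t+1}) ≤ Φ(x_{t+1}, y_t) (e.g., a Sinkhorn column update). Suppose Φ is bounded below: Φ(x,y) ≥ Φ* for all x, y. Then for every T ≥ 1, Σ_{t=0}^{T-1} KL(μ ‖ ρ_t) ≤ Φ(x_0, y_0) - Φ*;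 in particular there exists t < T with KL(μ ‖ ρ_t) ≤ (Φ(x_0, y_0) - Φ*)/T. -/
/-- The dual potential `Φ(x,y) = log ∑_{ij} K_ij e^{x_i + y_j} - ⟨μ,x⟩ - ⟨ν,y⟩`. -/
noncomputable def dualPotential (n : ℕ) (K : Matrix (Fin n) (Fin n) ℝ)
    (μ ν x y : Fin n → ℝ) : ℝ :=
  Real.log (∑ i, ∑ j, K i j * Real.exp (x i + y j))
    - (∑ i, μ i * x i) - (∑ j, ν j * y j)

/-- The `i`-th row marginal of the normalized scaled matrix
`p_ij = K_ij e^{x_i + y_j} / ∑_{kl} K_kl e^{x_k + y_l}`. -/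
noncomputable def rowMarginal (n : ℕ) (K : Matrix (Fin n) (Fin n) ℝ)
    (x y : Fin n → ℝ) (i : Fin n) : ℝ :=
  (∑ j, K i j * Real.exp (x i + y j)) / (∑ k, ∑ l, K k l * Real.exp (x k + y l))

/-- A Sinkhorn row update leaves the total mass of the scaled matrix unchanged. -/
lemma sum_exp_row_update {n : ℕ} (hn : 1 ≤ n) {K : Matrix (Fin n) (Fin n) ℝ}
    (hK : ∀ i j, 0 < K i j) {μ : Fin n → ℝ} (hμpos : ∀ i, 0 < μ i) (hμsum : ∑ i, μ i = 1)
    {x x' y : Fin n → ℝ}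
    (hx' : ∀ i, x' i = x i + Real.log (μ i / rowMarginal n K x y i)) :
    ∑ i, ∑ j, K i j * Real.exp (x' i + y j) = ∑ i, ∑ j, K i j * Real.exp (x i + y j) := by
  have : Nonempty (Fin n) := ⟨⟨0, hn⟩⟩
  have hr : ∀ i, 0 < ∑ j, K i j * Real.exp (x i + y j) := fun i =>
    Finset.sum_pos (fun j _ => mul_pos (hK i j) (Real.exp_pos _)) Finset.univ_nonempty
  have hZ : 0 < ∑ i, ∑ j, K i j * Real.exp (x i + y j) :=
    Finset.sum_pos (fun i _ => hr i) Finset.univ_nonempty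
  have hrow : ∀ i, ∑ j, K i j * Real.exp (x' i + y j)
      = μ i * ∑ k, ∑ l, K k l * Real.exp (x k + y l) := by
    intro i
    have hpos : 0 < μ i / rowMarginal n K x y i :=
      div_pos (hμpos i) (div_pos (hr i) hZ)
    calc ∑ j, K i j * Real.exp (x' i + y j)
        = (μ i / rowMarginal n K x y i) * ∑ j, K i j * Real.exp (x i + y j) := by
          rw [Finset.mul_sum]
          refine Finset.sum_congr rfl fun j _ => ?_
          rw [hx', add_right_comm, Real.exp_add, Real.exp_log hpos]
          ring
      _ = μ i * ∑ k, ∑ l, K k l * Real.exp (x k + y l) := by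
          have h := (hr i).ne'
          rw [rowMarginal, div_div_eq_mul_div, div_mul_cancel₀ _ h]
  rw [Finset.sum_congr rfl fun i _ => hrow i, ← Finset.sum_mul, hμsum, one_mul]

/-- A Sinkhorn row update decreases the dual potential by exactly `KL(μ ‖ ρ)`. -/
lemma dualPotential_row_update {n : ℕ} (hn : 1 ≤ n) {K : Matrix (Fin n) (Fin n) ℝ}
    (hK : ∀ i j, 0 < K i j) {μ : Fin n → ℝ} (hμpos : ∀ i, 0 < μ i) (hμsum : ∑ i, μ i = 1)
    (ν : Fin n → ℝ) {x x' y : Fin n → ℝ}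
    (hx' : ∀ i, x' i = x i + Real.log (μ i / rowMarginal n K x y i)) :
    dualPotential n K μ ν x' y
      = dualPotential n K μ ν x y - ∑ i, μ i * Real.log (μ i / rowMarginal n K x y i) := by
  have hlin : ∑ i, μ i * x' i
      = ∑ i, μ i * x i + ∑ i, μ i * Real.log (μ i / rowMarginal n K x y i) := by
    simp only [hx', mul_add, Finset.sum_add_distrib]
  rw [dualPotential, dualPotential, sum_exp_row_update hn hK hμpos hμsum hx', hlin]
  ring

/-- **Telescoping convergence bound for the Sinkhorn algorithm.** If each iteration
performs a Sinkhorn row update followed by any update of `y` that does not increase the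
dual potential `Φ`, and `Φ ≥ Φ*` everywhere, then for every `T ≥ 1` the KL divergences
`KL(μ ‖ ρ_t)` summed over `t < T` are at most `Φ(x_0, y_0) - Φ*`; in particular some
`t < T` has `KL(μ ‖ ρ_t) ≤ (Φ(x_0, y_0) - Φ*)/T`. -/
theorem sinkhorn_convergence
    (n : ℕ) (hn : 1 ≤ n) (K : Matrix (Fin n) (Fin n) ℝ)
    (hK : ∀ i j, 0 < K i j) (μ ν : Fin n → ℝ)
    (hμpos : ∀ i, 0 < μ i) (hμsum : ∑ i, μ i = 1)
    (hνpos : ∀ j, 0 < ν j) (hνsum : ∑ j, ν j = 1)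
    (x y : ℕ → Fin n → ℝ) (Φstar : ℝ)
    (hrow : ∀ t : ℕ, ∀ i : Fin n,
      x (t + 1) i = x t i + Real.log (μ i / rowMarginal n K (x t) (y t) i))
    (hcol : ∀ t : ℕ,
      dualPotential n K μ ν (x (t + 1)) (y (t + 1))
        ≤ dualPotential n K μ ν (x (t + 1)) (y t))
    (hlb : ∀ a b : Fin n → ℝ, Φstar ≤ dualPotential n K μ ν a b) :
    ∀ T : ℕ, 1 ≤ T →
      (∑ t ∈ Finset.range T, ∑ i, μ i * Real.log (μ i / rowMarginal n K (x t) (y t) i))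
        ≤ dualPotential n K μ ν (x 0) (y 0) - Φstar ∧
      ∃ t < T,
        (∑ i, μ i * Real.log (μ i / rowMarginal n K (x t) (y t) i))
          ≤ (dualPotential n K μ ν (x 0) (y 0) - Φstar) / T := by
  intro T hT
  have hstep : ∀ t, ∑ i, μ i * Real.log (μ i / rowMarginal n K (x t) (y t) i)
      ≤ dualPotential n K μ ν (x t) (y t)
        - dualPotential n K μ ν (x (t + 1)) (y (t + 1)) := fun t => by
    linarith [hcol t, dualPotential_row_update hn hK hμpos hμsum ν (hrow t)]
  have hsum : ∑ t ∈ Finset.range T,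
      ∑ i, μ i * Real.log (μ i / rowMarginal n K (x t) (y t) i)
        ≤ dualPotential n K μ ν (x 0) (y 0) - Φstar := by
    refine (Finset.sum_le_sum fun t _ => hstep t).trans ?_
    rw [Finset.sum_range_sub' fun t => dualPotential n K μ ν (x t) (y t)]
    linarith [hlb (x T) (y T)]
  refine ⟨hsum, ?_⟩
  have hT0 : (T : ℝ) ≠ 0 := Nat.cast_ne_zero.mpr (by omega)
  obtain ⟨t, ht, hle⟩ := Finset.exists_le_of_sum_le
    (s := Finset.range T)
    (f := fun t => ∑ i, μ i * Real.log (μ i / rowMarginal n K (x t) (y t) i))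
    (g := fun _ => (dualPotential n K μ ν (x 0) (y 0) - Φstar) / T)
    (Finset.nonempty_range_iff.mpr (by omega))
    (by simpa [mul_div_cancel₀ _ hT0] using hsum)
  exact ⟨t, Finset.mem_range.mp ht, hle⟩
end
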